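/- Let G be a finite simple graph with n vertices, Π_p a partial k-coloring of G with classes C_1,…,C_k (C_i := ∅ for i > k), uncolored set U, and let k0 ≥ k. Suppose U is partitioned into sets U^0, U^1,…,U^l where each U^j for j ∈ {1,…,l} is a clique in G. If Π_p extends to an equitable k0-coloring, then for every color f ∈ {1,…,k0}: ⌊n/k0⌋ − |C_f| ≤ Σ_{j=1}^{l} min{1, |{v ∈ U^j : f ∈ F(v)}|} + |{v ∈ U^0 : f ∈ F(v)}|. -/

import Mathlib

open Finset

variable {V : Type*}

/-- A `k`-coloring of `G`: `k` pairwise disjoint independent (possibly empty) classes covering `V`. -/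
def IsColoring (G : SimpleGraph V) (k : ℕ) (C : Fin k → Finset V) : Prop :=
  (∀ i j : Fin k, i ≠ j → Disjoint (C i) (C j)) ∧
  (∀ i : Fin k, ∀ v ∈ C i, ∀ w ∈ C i, ¬ G.Adj v w) ∧
  (∀ v : V, ∃ i : Fin k, v ∈ C i)

/-- A coloring is equitable if the sizes of any two color classes differ by at most one. -/
def IsEquitable {k : ℕ} (C : Fin k → Finset V) : Prop :=
  ∀ i j : Fin k, (C i).card ≤ (C j).card + 1

/-- A partial `k`-coloring of `G`: `k` pairwise disjoint independent classes. -/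
def IsPartialColoring (G : SimpleGraph V) (k : ℕ) (C : Fin k → Finset V) : Prop :=
  (∀ i j : Fin k, i ≠ j → Disjoint (C i) (C j)) ∧
  (∀ i : Fin k, ∀ v ∈ C i, ∀ w ∈ C i, ¬ G.Adj v w)

/-- The classes extended to `k0` colors: `C i` for `i < k` and `∅` for `i ≥ k`. -/
def Cext (k k0 : ℕ) (C : Fin k → Finset V) : Fin k0 → Finset V :=
  fun i => if h : (i : ℕ) < k then C ⟨i, h⟩ else ∅

/-- The set `U` of uncolored vertices of a partial coloring. -/
def uncolored [Fintype V] [DecidableEq V] {k : ℕ} (C : Fin k → Finset V) : Finset V :=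
  univ \ univ.biUnion fun i => C i

/-- `F(v)`: the free colors of `v`, i.e. colors `i ≤ k0` such that `v` has no neighbor in `C i`. -/
def freeColors (G : SimpleGraph V) [DecidableRel G.Adj] (k k0 : ℕ)
    (C : Fin k → Finset V) (v : V) : Finset (Fin k0) :=
  univ.filter fun i : Fin k0 => ∀ w ∈ Cext k k0 C i, ¬ G.Adj v w

/-- Every class of an equitable `k`-coloring has at least `⌊n / k⌋` vertices. -/
theorem IsEquitable.card_div_le_card [Fintype V] [DecidableEq V] {G : SimpleGraph V} {k : ℕ}
    {D : Fin k → Finset V} (hE : IsEquitable D) (hD : IsColoring G k D) (f : Fin k) :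
    Fintype.card V / k ≤ (D f).card := by
  by_contra! hlt
  have hcover : Fintype.card V ≤ ∑ i, (D i).card := by
    rw [← Finset.card_univ]
    refine le_trans (Finset.card_le_card fun v _ => ?_) Finset.card_biUnion_le
    obtain ⟨i, hi⟩ := hD.2.2 v
    exact Finset.mem_biUnion.2 ⟨i, Finset.mem_univ i, hi⟩
  have hsum : ∑ i, (D i).card < ∑ _i : Fin k, Fintype.card V / k :=
    Finset.sum_lt_sum (fun i _ => (hE i f).trans hlt) ⟨f, Finset.mem_univ f, hlt⟩
  have hmul := Nat.mul_div_le (Fintype.card V) k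
  simp only [Finset.sum_const, Finset.card_univ, Fintype.card_fin, smul_eq_mul] at hsum
  omega

/-- Color `i` of a partial coloring is contained in color `i` of any extension. -/
theorem Cext_subset {k k0 : ℕ} (hk : k ≤ k0) {C : Fin k → Finset V} {D : Fin k0 → Finset V}
    (hCD : ∀ i : Fin k, C i ⊆ D (Fin.castLE hk i)) (f : Fin k0) : Cext k k0 C f ⊆ D f := by
  unfold Cext
  split_ifs with h
  · exact hCD ⟨f, h⟩
  · exact Finset.empty_subset _

/-- A vertex that has color `f` in an extension, but not in the partial coloring, is uncolored
there. -/
theorem mem_uncolored_of_notMem_Cext [Fintype V] [DecidableEq V] {k k0 : ℕ} (hk : k ≤ k0)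
    {C : Fin k → Finset V} {D : Fin k0 → Finset V}
    (hD : ∀ i j : Fin k0, i ≠ j → Disjoint (D i) (D j))
    (hCD : ∀ i : Fin k, C i ⊆ D (Fin.castLE hk i)) {f : Fin k0} {v : V}
    (hv : v ∈ D f) (hvC : v ∉ Cext k k0 C f) : v ∈ uncolored C := by
  simp only [uncolored, Finset.mem_sdiff, Finset.mem_univ, true_and, Finset.mem_biUnion,
    not_exists]
  intro i hi
  have hif : Fin.castLE hk i = f := by
    by_contra hne
    exact Finset.disjoint_left.1 (hD _ _ hne) (hCD i hi) hv
  subst hif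
  exact hvC (by simpa [Cext] using hi)

theorem stmt16 [Fintype V] [DecidableEq V] (G : SimpleGraph V) [DecidableRel G.Adj]
    (k k0 l : ℕ) (hk : k ≤ k0) (C : Fin k → Finset V) (hC : IsPartialColoring G k C)
    (P : Fin (l + 1) → Finset V)
    (hPdisj : ∀ j j' : Fin (l + 1), j ≠ j' → Disjoint (P j) (P j'))
    (hPcover : univ.biUnion P = uncolored C)
    (hclique : ∀ j : Fin (l + 1), j ≠ 0 → ∀ v ∈ P j, ∀ w ∈ P j, v ≠ w → G.Adj v w)
    (hext : ∃ D : Fin k0 → Finset V, IsColoring G k0 D ∧ IsEquitable D ∧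
      ∀ i : Fin k, C i ⊆ D (Fin.castLE hk i)) :
    ∀ f : Fin k0,
      ((Fintype.card V / k0 : ℕ) : ℤ) - ((Cext k k0 C f).card : ℤ)
        ≤ ((∑ j ∈ (univ : Finset (Fin (l + 1))).filter (fun j => j ≠ 0),
              min 1 (((P j).filter fun v => f ∈ freeColors G k k0 C v).card) : ℕ) : ℤ)
          + (((P 0).filter fun v => f ∈ freeColors G k k0 C v).card : ℤ) := by
  obtain ⟨D, hD, hE, hCD⟩ := hext
  intro f
  let A : Fin (l + 1) → Finset V := fun j => (P j).filter fun v => f ∈ freeColors G k k0 C v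
  have hfree : ∀ v ∈ D f, f ∈ freeColors G k k0 C v := by
    intro v hv
    simp only [freeColors, Finset.mem_filter, Finset.mem_univ, true_and]
    exact fun w hw => hD.2.1 f v hv w (Cext_subset hk hCD f hw)
  have hsub : D f ⊆ Cext k k0 C f ∪ univ.biUnion fun j => A j ∩ D f := by
    intro v hv
    by_cases hvC : v ∈ Cext k k0 C f
    · exact Finset.mem_union_left _ hvC
    · have hvU := mem_uncolored_of_notMem_Cext hk hD.1 hCD hv hvC
      rw [← hPcover] at hvU
      obtain ⟨j, -, hj⟩ := Finset.mem_biUnion.1 hvU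
      exact Finset.mem_union_right _ (Finset.mem_biUnion.2 ⟨j, Finset.mem_univ j,
        Finset.mem_inter.2 ⟨Finset.mem_filter.2 ⟨hj, hfree v hv⟩, hv⟩⟩)
  have hcard : (D f).card ≤ (Cext k k0 C f).card + ∑ j, (A j ∩ D f).card :=
    (Finset.card_le_card hsub).trans ((Finset.card_union_le _ _).trans
      (Nat.add_le_add_left Finset.card_biUnion_le _))
  have hsplit : ∑ j, (A j ∩ D f).card =
      ∑ j ∈ univ.filter (fun j => j ≠ 0), (A j ∩ D f).card + (A 0 ∩ D f).card := by
    rw [Finset.filter_ne' univ, Finset.sum_erase_add _ _ (Finset.mem_univ _)]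
  have hcliques : ∑ j ∈ univ.filter (fun j => j ≠ 0), (A j ∩ D f).card ≤
      ∑ j ∈ univ.filter (fun j => j ≠ 0), min 1 (A j).card := by
    refine Finset.sum_le_sum fun j hj => le_min ?_ (Finset.card_le_card Finset.inter_subset_left)
    refine Finset.card_le_one.2 fun v hv w hw => ?_
    rw [Finset.mem_inter, Finset.mem_filter] at hv hw
    by_contra hne
    exact hD.2.1 f v hv.2 w hw.2
      (hclique j (Finset.mem_filter.1 hj).2 v hv.1.1 w hw.1.1 hne)
  have hzero : (A 0 ∩ D f).card ≤ (A 0).card := Finset.card_le_card Finset.inter_subset_left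
  have hdiv := hE.card_div_le_card hD f
  change ((Fintype.card V / k0 : ℕ) : ℤ) - ((Cext k k0 C f).card : ℤ) ≤
    ((∑ j ∈ univ.filter (fun j => j ≠ 0), min 1 (A j).card : ℕ) : ℤ) + ((A 0).card : ℤ)
  omega
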